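/- arXiv:1209.3202 — 4 statements merged into one kernel-verified Lean document; each statement's English description precedes it below -/
import Mathlib

section
/- Let L be the free ℤ-module with basis e₀, e_C, e_F, e₄, equipped with the symmetric bilinear form determined by ⟨e_C,e_C⟩ = -2, ⟨e_C,e_F⟩ = ⟨e_F,e_C⟩ = 1, ⟨e₀,e₄⟩ = ⟨e₄,e₀⟩ = -1, and all other pairings of basis vectors equal to 0. Then the linear map φ : L → L determined by φ(e₀) = -e_C - e_F, φ(e₄) = e_F, φ(e_C) = e₀ + e₄, φ(e_F) = -e₄ is an isometry, i.e. ⟨φ(x),φ(y)⟩ = ⟨x,y⟩ for all x, y ∈ L. -/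
/-- On the free ℤ-module with basis `e 0 = e₀`, `e 1 = e_C`, `e 2 = e_F`,
`e 3 = e₄`, with the symmetric bilinear form determined by `⟨e_C,e_C⟩ = -2`,
`⟨e_C,e_F⟩ = ⟨e_F,e_C⟩ = 1`, `⟨e₀,e₄⟩ = ⟨e₄,e₀⟩ = -1` and all other pairings of basis
vectors zero, the linear map `φ` determined by `φ e₀ = -e_C - e_F`, `φ e₄ = e_F`,
`φ e_C = e₀ + e₄`, `φ e_F = -e₄` is an isometry. -/
theorem stmt_1 (B : LinearMap.BilinForm ℤ (Fin 4 → ℤ))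
    (φ : (Fin 4 → ℤ) →ₗ[ℤ] (Fin 4 → ℤ))
    (e : Fin 4 → (Fin 4 → ℤ)) (he : ∀ i, e i = Pi.single i 1)
    (hCC : B (e 1) (e 1) = -2)
    (hCF : B (e 1) (e 2) = 1) (hFC : B (e 2) (e 1) = 1)
    (h04 : B (e 0) (e 3) = -1) (h40 : B (e 3) (e 0) = -1)
    (hother : ∀ i j : Fin 4,
      ¬((i = 1 ∧ j = 1) ∨ (i = 1 ∧ j = 2) ∨ (i = 2 ∧ j = 1) ∨
          (i = 0 ∧ j = 3) ∨ (i = 3 ∧ j = 0)) →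
      B (e i) (e j) = 0)
    (hφ0 : φ (e 0) = -e 1 - e 2)
    (hφ4 : φ (e 3) = e 2)
    (hφC : φ (e 1) = e 0 + e 3)
    (hφF : φ (e 2) = -e 3) :
    ∀ x y : Fin 4 → ℤ, B (φ x) (φ y) = B x y := by
  have hb : ∀ i, Pi.basisFun ℤ (Fin 4) i = e i := fun i => by
    rw [he, Pi.basisFun_apply]
  have key : B.compl₁₂ φ φ = B := by
    refine LinearMap.ext_basis (Pi.basisFun ℤ (Fin 4)) (Pi.basisFun ℤ (Fin 4)) fun i j => ?_
    rw [hb, hb, LinearMap.compl₁₂_apply]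
    have h00 := hother 0 0 (by decide)
    have h01 := hother 0 1 (by decide)
    have h02 := hother 0 2 (by decide)
    have h10 := hother 1 0 (by decide)
    have h13 := hother 1 3 (by decide)
    have h20 := hother 2 0 (by decide)
    have h22 := hother 2 2 (by decide)
    have h23 := hother 2 3 (by decide)
    have h31 := hother 3 1 (by decide)
    have h32 := hother 3 2 (by decide)
    have h33 := hother 3 3 (by decide)
    clear hother he hb
    fin_cases i <;> fin_cases j <;>
      simp [hφ0, hφ4, hφC, hφF, hCC, hCF, hFC, h04, h40, h00, h01, h02, h10, h13, h20, h22,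
        h23, h31, h32, h33]
  intro x y
  exact LinearMap.congr_fun₂ key x y
end

section
/- Let V be a finite-dimensional real vector space, I : V → V a linear map with I ∘ I = -id, and ω_J, ω_K alternating bilinear forms on V with ω_J nondegenerate, satisfying ω_J(Ix, y) = -ω_K(x, y) and ω_K(Ix, y) = ω_J(x, y) for all x, y ∈ V. On V ⊕ V* define the linear maps 𝓙_I(X, ξ) = (-IX, ξ ∘ I) and 𝓙_{ω_J}(X, ξ) = (-ω_J⁻¹ξ, ω_J X), where ω_J is regarded as an isomorphism V → V*. Then for every θ ∈ ℝ the map 𝓙_θ := (cos θ)·𝓙_I + (sin θ)·𝓙_{ω_J} satisfies 𝓙_θ ∘ 𝓙_θ = -id on V ⊕ V*. -/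
/-- The generalized complex structure of complex type on `V ⊕ V*`:
`𝓙_I(X, ξ) = (-IX, ξ ∘ I)`. -/
def cplxJ {V : Type*} [AddCommGroup V] [Module ℝ V] (I : V →ₗ[ℝ] V)
    (p : V × Module.Dual ℝ V) : V × Module.Dual ℝ V :=
  (-(I p.1), p.2 ∘ₗ I)

/-- The generalized complex structure of symplectic type on `V ⊕ V*`:
`𝓙_ω(X, ξ) = (-ω⁻¹ξ, ωX)`, where the alternating form `ω` is regarded as a map
`V → V*` and `ω⁻¹` is its (classically chosen) inverse. -/
noncomputable def sympJ {V : Type*} [AddCommGroup V] [Module ℝ V]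
    (ω : LinearMap.BilinForm ℝ V) (p : V × Module.Dual ℝ V) : V × Module.Dual ℝ V :=
  haveI : Nonempty V := ⟨0⟩
  (-(Function.invFun (ω : V →ₗ[ℝ] Module.Dual ℝ V) p.2), ω p.1)

/-- If `ω_J + iω_K` is of type `(2,0)` with respect to `I`, then `I` is self-adjoint
with respect to `ω_J`. -/
theorem selfAdjoint_of_compatible {V : Type*} [AddCommGroup V] [Module ℝ V]
    (I : V →ₗ[ℝ] V) (ωJ ωK : LinearMap.BilinForm ℝ V)
    (hJalt : ωJ.IsAlt) (hKalt : ωK.IsAlt)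
    (hJK : ∀ x y, ωJ (I x) y = -ωK x y) (x : V) :
    ωJ x ∘ₗ I = ωJ (I x) := by
  ext y
  rw [LinearMap.comp_apply, hJK, ← LinearMap.IsAlt.neg hJalt, hJK, neg_neg,
    LinearMap.IsAlt.neg hKalt]

/-- `𝓙_ω(X, ωY) = (-Y, ωX)` whenever `ω` is injective. -/
theorem sympJ_apply_apply {V : Type*} [AddCommGroup V] [Module ℝ V]
    (ω : LinearMap.BilinForm ℝ V) (hω : Function.Injective ω) (X Y : V) :
    sympJ ω (X, ω Y) = (-Y, ω X) := by
  have : Nonempty V := ⟨0⟩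
  simp only [sympJ, Function.leftInverse_invFun hω Y]

/-- if `I² = -id`, `ω_J, ω_K` are alternating with `ω_J` nondegenerate and
`ω_J(Ix,y) = -ω_K(x,y)`, `ω_K(Ix,y) = ω_J(x,y)`, then for every `θ ∈ ℝ` the map
`𝓙_θ = (cos θ)·𝓙_I + (sin θ)·𝓙_{ω_J}` on `V ⊕ V*` satisfies `𝓙_θ ∘ 𝓙_θ = -id`. -/
theorem stmt_7 (V : Type*) [AddCommGroup V] [Module ℝ V] [FiniteDimensional ℝ V]
    (I : V →ₗ[ℝ] V) (hI : I ∘ₗ I = -(LinearMap.id : V →ₗ[ℝ] V))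
    (ωJ ωK : LinearMap.BilinForm ℝ V)
    (hJalt : ωJ.IsAlt) (hKalt : ωK.IsAlt)
    (hJnd : Function.Bijective (ωJ : V → Module.Dual ℝ V))
    (hJK : ∀ x y, ωJ (I x) y = -ωK x y) (hKJ : ∀ x y, ωK (I x) y = ωJ x y)
    (θ : ℝ) :
    let Jθ : V × Module.Dual ℝ V → V × Module.Dual ℝ V :=
      fun q => Real.cos θ • cplxJ I q + Real.sin θ • sympJ ωJ q
    ∀ p : V × Module.Dual ℝ V, Jθ (Jθ p) = -p := by
  have hself : ∀ x, ωJ x ∘ₗ I = ωJ (I x) := selfAdjoint_of_compatible I ωJ ωK hJalt hKalt hJK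
  have hII : ∀ x, I (I x) = -x := fun x => LinearMap.congr_fun hI x
  have hJ : ∀ X Y : V, Real.cos θ • cplxJ I (X, ωJ Y) + Real.sin θ • sympJ ωJ (X, ωJ Y) =
      (-(Real.cos θ • I X + Real.sin θ • Y), ωJ (Real.cos θ • I Y + Real.sin θ • X)) := by
    intro X Y
    rw [sympJ_apply_apply ωJ hJnd.injective, cplxJ, hself]
    ext1
    · simp only [Prod.fst_add, Prod.smul_fst]
      module
    · simp only [Prod.snd_add, Prod.smul_snd, map_add, map_smul]
  rintro Jθ ⟨X, ξ⟩
  obtain ⟨Y, rfl⟩ := hJnd.surjective ξ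
  have hsc := Real.sin_sq_add_cos_sq θ
  simp only [Jθ, hJ, Prod.neg_mk, ← map_neg, Prod.mk.injEq]
  refine ⟨?_, congrArg ωJ ?_⟩
  · simp only [map_neg, map_add, map_smul, hII]
    linear_combination (norm := module) -hsc • X
  · simp only [map_add, map_smul, hII]
    linear_combination (norm := module) -hsc • Y
end

section
/- Let V be a finite-dimensional real vector space, I : V → V a linear map with I ∘ I = -id, and ω_J, ω_K alternating bilinear forms on V with ω_J nondegenerate, satisfying ω_J(Ix, y) = -ω_K(x, y) and ω_K(Ix, y) = ω_J(x, y) for all x, y ∈ V. On V ⊕ V* define 𝓙_I(X, ξ) = (-IX, ξ ∘ I), 𝓙_ω(X, ξ) = (-ω⁻¹ξ, ωX) for any nondegenerate alternating form ω, and for an alternating bilinear form B (regarded as a map V → V*) define e^B(X, ξ) := (X, ξ + BX). Then for every θ ∈ ℝ which is not an integer multiple of π, setting B := -(cot θ)·ω_K, one has (cos θ)·𝓙_I + (sin θ)·𝓙_{ω_J} = e^{-B} ∘ 𝓙_{(csc θ)ω_J} ∘ e^{B}. -/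
/-- The B-field transform `e^B(X, ξ) = (X, ξ + BX)` on `V ⊕ V*`, for an alternating
bilinear form `B` regarded as a map `V → V*`. -/
def bfieldE {V : Type*} [AddCommGroup V] [Module ℝ V] (B : LinearMap.BilinForm ℝ V)
    (p : V × Module.Dual ℝ V) : V × Module.Dual ℝ V :=
  (p.1, p.2 + B p.1)

/-- If `ω v = ξ` and `ω` is injective, then `𝓙_ω(X, ξ) = (-v, ωX)`. -/
theorem sympJ_eq_of_apply_eq {V : Type*} [AddCommGroup V] [Module ℝ V]
    {ω : LinearMap.BilinForm ℝ V} (hω : Function.Injective (ω : V → Module.Dual ℝ V))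
    (X : V) {v : V} {ξ : Module.Dual ℝ V} (hv : ω v = ξ) :
    sympJ ω (X, ξ) = (-v, ω X) := by
  subst hv
  have : Nonempty V := ⟨0⟩
  exact Prod.ext (congrArg Neg.neg (Function.leftInverse_invFun hω v)) rfl

/-- if `I² = -id`, `ω_J, ω_K` are alternating with `ω_J` nondegenerate and
`ω_J(Ix,y) = -ω_K(x,y)`, `ω_K(Ix,y) = ω_J(x,y)`, then for every `θ ∈ ℝ` not an integer
multiple of `π`, with `B = -(cot θ)·ω_K`, one has
`(cos θ)·𝓙_I + (sin θ)·𝓙_{ω_J} = e^{-B} ∘ 𝓙_{(csc θ)ω_J} ∘ e^{B}` on `V ⊕ V*`. -/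
theorem stmt_8 (V : Type*) [AddCommGroup V] [Module ℝ V] [FiniteDimensional ℝ V]
    (I : V →ₗ[ℝ] V) (hI : I ∘ₗ I = -(LinearMap.id : V →ₗ[ℝ] V))
    (ωJ ωK : LinearMap.BilinForm ℝ V)
    (hJalt : ωJ.IsAlt) (hKalt : ωK.IsAlt)
    (hJnd : Function.Bijective (ωJ : V → Module.Dual ℝ V))
    (hJK : ∀ x y, ωJ (I x) y = -ωK x y) (hKJ : ∀ x y, ωK (I x) y = ωJ x y)
    (θ : ℝ) (hθ : ∀ n : ℤ, θ ≠ n * Real.pi) :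
    let B : LinearMap.BilinForm ℝ V := -(Real.cot θ) • ωK
    ∀ p : V × Module.Dual ℝ V,
      Real.cos θ • cplxJ I p + Real.sin θ • sympJ ωJ p
        = bfieldE (-B) (sympJ ((Real.sin θ)⁻¹ • ωJ) (bfieldE B p)) := by
  have hs : Real.sin θ ≠ 0 := fun h => by
    obtain ⟨n, hn⟩ := Real.sin_eq_zero_iff.mp h
    exact hθ n hn.symm
  intro B
  rintro ⟨X, ξ⟩
  obtain ⟨v, rfl⟩ := hJnd.2 ξ
  have hinj : Function.Injective
      (((Real.sin θ)⁻¹ • ωJ : LinearMap.BilinForm ℝ V) : V → Module.Dual ℝ V) := fun x y hxy =>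
    hJnd.1 (smul_right_injective _ (inv_ne_zero hs) hxy)
  have hpre : ((Real.sin θ)⁻¹ • ωJ) (Real.sin θ • v + Real.cos θ • I X) = ωJ v + B X := by
    ext y
    simp only [B, LinearMap.smul_apply, LinearMap.add_apply, map_add, map_smul, smul_eq_mul, hJK,
      Real.cot_eq_cos_div_sin]
    field_simp
  have hcomp : ∀ y, ωJ v (I y) = -ωK v y := fun y => by
    linear_combination -(hJalt.neg_eq (I y) v) - hJK y v - hKalt.neg_eq y v
  rw [sympJ_eq_of_apply_eq hJnd.1 X rfl,
    show bfieldE B (X, ωJ v) = (X, ωJ v + B X) from rfl, sympJ_eq_of_apply_eq hinj X hpre]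
  refine Prod.ext ?_ (LinearMap.ext fun y => ?_)
  · simp only [cplxJ, bfieldE, Prod.fst_add, Prod.smul_fst, smul_neg]
    abel
  · simp only [cplxJ, bfieldE, B, Prod.snd_add, Prod.smul_snd, LinearMap.add_apply,
      LinearMap.smul_apply, LinearMap.neg_apply, LinearMap.comp_apply, map_neg, map_add, map_smul,
      smul_eq_mul, hcomp, hKJ, Real.cot_eq_cos_div_sin]
    field_simp
    linear_combination (ωJ X y) * Real.sin_sq_add_cos_sq θ
end

section
/- Let V be a finite-dimensional real vector space, I : V → V a linear map with I ∘ I = -id, and ω_J, ω_K alternating bilinear forms on V with ω_J nondegenerate, satisfying ω_J(Ix, y) = -ω_K(x, y) and ω_K(Ix, y) = ω_J(x, y) for all x, y ∈ V. Then ω_K is also nondegenerate, and on V ⊕ V* the three maps 𝓙_I(X, ξ) = (-IX, ξ ∘ I), 𝓙_{ω_J}(X, ξ) = (-ω_J⁻¹ξ, ω_J X), 𝓙_{ω_K}(X, ξ) = (-ω_K⁻¹ξ, ω_K X) each square to -id and pairwise anticommute. Consequently, for all real numbers a, b, c with a² + b² + c² = 1, the map 𝓙 := a·𝓙_I + b·𝓙_{ω_J}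 + c·𝓙_{ω_K} satisfies 𝓙 ∘ 𝓙 = -id. -/
section GeneralizedComplex

variable {V : Type*} [AddCommGroup V] [Module ℝ V]

theorem exists_linearMap_eq_cplxJ (I : V →ₗ[ℝ] V) :
    ∃ A : Module.End ℝ (V × Module.Dual ℝ V), ∀ p, A p = cplxJ I p :=
  ⟨(-(I ∘ₗ LinearMap.fst ℝ V (Module.Dual ℝ V))).prod
    (Module.Dual.transpose (R := ℝ) I ∘ₗ LinearMap.snd ℝ V (Module.Dual ℝ V)), fun _ => rfl⟩

theorem sympJ_apply_of_injective {ω : LinearMap.BilinForm ℝ V}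
    (hω : Function.Injective (ω : V → Module.Dual ℝ V)) (x y : V) :
    sympJ ω (x, ω y) = (-y, ω x) := by
  have : Nonempty V := ⟨0⟩
  exact Prod.ext (congrArg Neg.neg (Function.leftInverse_invFun hω y)) rfl

theorem exists_linearMap_eq_sympJ {ω : LinearMap.BilinForm ℝ V}
    (hω : Function.Bijective (ω : V → Module.Dual ℝ V)) :
    ∃ A : Module.End ℝ (V × Module.Dual ℝ V), ∀ p, A p = sympJ ω p := by
  let e : V ≃ₗ[ℝ] Module.Dual ℝ V := LinearEquiv.ofBijective ω hω
  refine ⟨(-(e.symm.toLinearMap ∘ₗ LinearMap.snd ℝ V (Module.Dual ℝ V))).prod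
    (ω ∘ₗ LinearMap.fst ℝ V (Module.Dual ℝ V)), ?_⟩
  rintro ⟨x, ξ⟩
  obtain ⟨y, rfl⟩ := hω.2 ξ
  rw [sympJ_apply_of_injective hω.1]
  exact Prod.ext (congrArg Neg.neg (e.symm_apply_apply y)) rfl

theorem cplxJ_cplxJ {I : V →ₗ[ℝ] V} (hI : ∀ x, I (I x) = -x) (p : V × Module.Dual ℝ V) :
    cplxJ I (cplxJ I p) = -p := by
  ext <;> simp [cplxJ, hI]

theorem sympJ_sympJ {ω : LinearMap.BilinForm ℝ V}
    (hω : Function.Bijective (ω : V → Module.Dual ℝ V)) (p : V × Module.Dual ℝ V) :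
    sympJ ω (sympJ ω p) = -p := by
  obtain ⟨x, ξ⟩ := p
  obtain ⟨y, rfl⟩ := hω.2 ξ
  rw [sympJ_apply_of_injective hω.1, sympJ_apply_of_injective hω.1, map_neg, Prod.neg_mk]

theorem cplxJ_sympJ_add_sympJ_cplxJ {I : V →ₗ[ℝ] V} {ω : LinearMap.BilinForm ℝ V}
    (hω : Function.Bijective (ω : V → Module.Dual ℝ V))
    (hIω : ∀ x y, ω x (I y) = ω (I x) y) (p : V × Module.Dual ℝ V) :
    cplxJ I (sympJ ω p) + sympJ ω (cplxJ I p) = 0 := by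
  obtain ⟨x, ξ⟩ := p
  obtain ⟨y, rfl⟩ := hω.2 ξ
  have hcomp : ∀ z, ω z ∘ₗ I = ω (I z) := fun z => LinearMap.ext (hIω z)
  rw [sympJ_apply_of_injective hω.1]
  simp only [cplxJ, hcomp]
  rw [sympJ_apply_of_injective hω.1]
  simp

theorem sympJ_sympJ_add_sympJ_sympJ {I : V →ₗ[ℝ] V} {ω η : LinearMap.BilinForm ℝ V}
    (hω : Function.Bijective (ω : V → Module.Dual ℝ V))
    (hη : Function.Bijective (η : V → Module.Dual ℝ V))
    (hωη : ∀ x, ω (I x) = -η x) (hηω : ∀ x, η (I x) = ω x) (p : V × Module.Dual ℝ V) :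
    sympJ ω (sympJ η p) + sympJ η (sympJ ω p) = 0 := by
  obtain ⟨x, ξ⟩ := p
  obtain ⟨y, rfl⟩ := hω.2 ξ
  have hηx : η x = ω (-I x) := by rw [map_neg, hωη, neg_neg]
  rw [sympJ_apply_of_injective hω.1, ← hηω y, ← hηω x, sympJ_apply_of_injective hη.1,
    sympJ_apply_of_injective hη.1, hηx, sympJ_apply_of_injective hω.1]
  simp [hωη]

end GeneralizedComplex

/-- A point of the unit sphere spanned by three anticommuting complex structures is again a
complex structure. -/
theorem sphere_combination_mul_self {R E : Type*} [CommRing R] [Ring E] [Algebra R E]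
    {A B C : E} (hA : A * A = -1) (hB : B * B = -1) (hC : C * C = -1)
    (hAB : A * B + B * A = 0) (hAC : A * C + C * A = 0) (hBC : B * C + C * B = 0)
    {a b c : R} (h : a ^ 2 + b ^ 2 + c ^ 2 = 1) :
    (a • A + b • B + c • C) * (a • A + b • B + c • C) = -1 := by
  calc (a • A + b • B + c • C) * (a • A + b • B + c • C)
      = a ^ 2 • (A * A) + b ^ 2 • (B * B) + c ^ 2 • (C * C) + (a * b) • (A * B + B * A)
        + (a * c) • (A * C + C * A) + (b * c) • (B * C + C * B) := by
        simp only [add_mul, mul_add, smul_mul_assoc, mul_smul_comm]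
        module
    _ = -((a ^ 2 + b ^ 2 + c ^ 2) • (1 : E)) := by
        rw [hA, hB, hC, hAB, hAC, hBC]
        module
    _ = -1 := by rw [h, one_smul]

/-- if `I² = -id`, `ω_J, ω_K` are alternating with `ω_J` nondegenerate and
`ω_J(Ix,y) = -ω_K(x,y)`, `ω_K(Ix,y) = ω_J(x,y)`, then `ω_K` is also nondegenerate, the
three maps `𝓙_I, 𝓙_{ω_J}, 𝓙_{ω_K}` on `V ⊕ V*` each square to `-id` and pairwise
anticommute, and for all `a, b, c ∈ ℝ` with `a² + b² + c² = 1` the map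
`𝓙 = a·𝓙_I + b·𝓙_{ω_J} + c·𝓙_{ω_K}` satisfies `𝓙 ∘ 𝓙 = -id`. -/
theorem stmt_9 (V : Type*) [AddCommGroup V] [Module ℝ V] [FiniteDimensional ℝ V]
    (I : V →ₗ[ℝ] V) (hI : I ∘ₗ I = -(LinearMap.id : V →ₗ[ℝ] V))
    (ωJ ωK : LinearMap.BilinForm ℝ V)
    (hJalt : ωJ.IsAlt) (hKalt : ωK.IsAlt)
    (hJnd : Function.Bijective (ωJ : V → Module.Dual ℝ V))
    (hJK : ∀ x y, ωJ (I x) y = -ωK x y) (hKJ : ∀ x y, ωK (I x) y = ωJ x y) :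
    Function.Bijective (ωK : V → Module.Dual ℝ V) ∧
      (∀ p, cplxJ I (cplxJ I p) = -p) ∧
      (∀ p, sympJ ωJ (sympJ ωJ p) = -p) ∧
      (∀ p, sympJ ωK (sympJ ωK p) = -p) ∧
      (∀ p, cplxJ I (sympJ ωJ p) + sympJ ωJ (cplxJ I p) = 0) ∧
      (∀ p, cplxJ I (sympJ ωK p) + sympJ ωK (cplxJ I p) = 0) ∧
      (∀ p, sympJ ωJ (sympJ ωK p) + sympJ ωK (sympJ ωJ p) = 0) ∧
      (∀ a b c : ℝ, a ^ 2 + b ^ 2 + c ^ 2 = 1 →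
        ∀ p : V × Module.Dual ℝ V,
          (fun q => a • cplxJ I q + b • sympJ ωJ q + c • sympJ ωK q)
              ((fun q => a • cplxJ I q + b • sympJ ωJ q + c • sympJ ωK q) p) = -p) := by
  have hII : ∀ x, I (I x) = -x := fun x => LinearMap.congr_fun hI x
  have hJK' : ∀ x, ωJ (I x) = -ωK x := fun x => LinearMap.ext (hJK x)
  have hKJ' : ∀ x, ωK (I x) = ωJ x := fun x => LinearMap.ext (hKJ x)
  have hIbij : Function.Bijective I :=
    Function.bijective_iff_has_inverse.2
      ⟨fun x => -I x, fun x => by simp [hII], fun x => by simp [hII]⟩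
  have hKnd : Function.Bijective (ωK : V → Module.Dual ℝ V) := by
    refine (Function.Bijective.of_comp_iff _ hIbij).1 ?_
    rwa [show (ωK : V → Module.Dual ℝ V) ∘ I = ωJ from funext hKJ']
  have hJI : ∀ x y, ωJ x (I y) = ωJ (I x) y := fun x y => by
    rw [← hJalt.neg_eq, hJK, hJK, ← hKalt.neg_eq x y, neg_neg]
  have hKI : ∀ x y, ωK x (I y) = ωK (I x) y := fun x y => by
    rw [← hKalt.neg_eq, hKJ, hKJ, hJalt.neg_eq]
  have hA2 := cplxJ_cplxJ hII
  have hB2 := sympJ_sympJ hJnd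
  have hC2 := sympJ_sympJ hKnd
  have hAB := cplxJ_sympJ_add_sympJ_cplxJ hJnd hJI
  have hAC := cplxJ_sympJ_add_sympJ_cplxJ hKnd hKI
  have hBC := sympJ_sympJ_add_sympJ_sympJ hJnd hKnd hJK' hKJ'
  refine ⟨hKnd, hA2, hB2, hC2, hAB, hAC, hBC, fun a b c habc p => ?_⟩
  obtain ⟨A, hA⟩ := exists_linearMap_eq_cplxJ I
  obtain ⟨B, hB⟩ := exists_linearMap_eq_sympJ hJnd
  obtain ⟨C, hC⟩ := exists_linearMap_eq_sympJ hKnd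
  simp only [← hA, ← hB, ← hC] at hA2 hB2 hC2 hAB hAC hBC ⊢
  exact LinearMap.congr_fun (sphere_combination_mul_self (A := A) (B := B) (C := C)
    (LinearMap.ext hA2) (LinearMap.ext hB2) (LinearMap.ext hC2)
    (LinearMap.ext hAB) (LinearMap.ext hAC) (LinearMap.ext hBC) habc) p
end
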